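/- For all multi-indices I, J and all indices a, b ∈ {1,2,3} there exists a constant C > 0 such that for every smooth function u on {(t,x) ∈ ℝ × ℝ³ : t > 0} and every point (t,x) with t ≥ 1 and |x| ≤ t, one has |∂^I L^J (∂̲_a ∂̲_b u)(t,x)| ≤ C t^{-2} Σ_{|I'| ≤ |I|, |J'| ≤ |J|} ( |∂^{I'} L^{J'} (L_a L_b u)(t,x)| + |∂^{I'} L^{J'} (L_b u)(t,x)| ), where ∂̲_c u = (xᶜ/t)∂_t u + ∂_c u denotes the semi-hyperboloidal frame derivative. -/

import Mathlib

noncomputable section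
open MeasureTheory

/-- Euclidean 3-space. -/
abbrev E3 := EuclideanSpace ℝ (Fin 3)

/-- The coordinate directions of `ℝ × ℝ³` (index `0` is time). -/
def dir4 : Fin 4 → ℝ × E3 :=
  ![(1, 0), (0, EuclideanSpace.single 0 1), (0, EuclideanSpace.single 1 1),
    (0, EuclideanSpace.single 2 1)]

/-- The translation field `∂_α` (with `∂_0 = ∂_t`). -/
def pd (α : Fin 4) (u : ℝ × E3 → ℝ) : ℝ × E3 → ℝ := fun p => fderiv ℝ u p (dir4 α)

/-- The Lorentz boost `L_a = xᵃ∂_t + t∂_a`. -/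
def Lb (a : Fin 3) (u : ℝ × E3 → ℝ) : ℝ × E3 → ℝ :=
  fun p => p.2 a * fderiv ℝ u p (1, 0) + p.1 * fderiv ℝ u p (0, EuclideanSpace.single a 1)

/-- The semi-hyperboloidal frame field `∂̲_a = (xᵃ/t)∂_t + ∂_a`. -/
def sh (a : Fin 3) (u : ℝ × E3 → ℝ) : ℝ × E3 → ℝ :=
  fun p => p.2 a / p.1 * fderiv ℝ u p (1, 0) + fderiv ℝ u p (0, EuclideanSpace.single a 1)

/-- The composition `∂^I` of translations prescribed by `I : Fin m → Fin 4`. -/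
def pdF {m : ℕ} (I : Fin m → Fin 4) (u : ℝ × E3 → ℝ) : ℝ × E3 → ℝ :=
  (List.ofFn I).foldr pd u

/-- The composition `L^J` of Lorentz boosts prescribed by `J : Fin n → Fin 3`. -/
def LbF {n : ℕ} (J : Fin n → Fin 3) (u : ℝ × E3 → ℝ) : ℝ × E3 → ℝ :=
  (List.ofFn J).foldr Lb u

/-- The open half-space `{t > 0}`. -/
def halfSpace : Set (ℝ × E3) := {p | 0 < p.1}

theorem isOpen_halfSpace : IsOpen halfSpace := isOpen_lt continuous_const continuous_fst

/-- Smoothness on the half-space `{t > 0}`. -/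
abbrev SmoothHalf (u : ℝ × E3 → ℝ) : Prop := ContDiffOn ℝ (⊤ : ℕ∞) u halfSpace

theorem SmoothHalf.differentiableAt {u : ℝ × E3 → ℝ} (hu : SmoothHalf u) {p : ℝ × E3}
    (hp : p ∈ halfSpace) : DifferentiableAt ℝ u p :=
  (hu.contDiffAt (isOpen_halfSpace.mem_nhds hp)).differentiableAt (by simp)

/-- The derivative of `u` along the vector field `w`. -/
def fieldDeriv (w : ℝ × E3 → ℝ × E3) (u : ℝ × E3 → ℝ) : ℝ × E3 → ℝ := fun p => fderiv ℝ u p (w p)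

theorem SmoothHalf.fieldDeriv {w : ℝ × E3 → ℝ × E3} (hw : ContDiff ℝ (⊤ : ℕ∞) w)
    {u : ℝ × E3 → ℝ} (hu : SmoothHalf u) : SmoothHalf (fieldDeriv w u) :=
  (hu.fderiv_of_isOpen isOpen_halfSpace (by simp)).clm_apply hw.contDiffOn

theorem fieldDeriv_congr (w : ℝ × E3 → ℝ × E3) {u v : ℝ × E3 → ℝ} (h : Set.EqOn u v halfSpace) :
    Set.EqOn (fieldDeriv w u) (fieldDeriv w v) halfSpace := fun p hp => by
  have : u =ᶠ[nhds p] v := h.eventuallyEq_of_mem (isOpen_halfSpace.mem_nhds hp)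
  simp [fieldDeriv, this.fderiv_eq]

theorem fieldDeriv_add (w : ℝ × E3 → ℝ × E3) {u v : ℝ × E3 → ℝ} (hu : SmoothHalf u)
    (hv : SmoothHalf v) :
    Set.EqOn (fieldDeriv w (u + v)) (fieldDeriv w u + fieldDeriv w v) halfSpace := fun p hp => by
  simp [fieldDeriv, fderiv_add (hu.differentiableAt hp) (hv.differentiableAt hp)]

theorem fieldDeriv_mul (w : ℝ × E3 → ℝ × E3) {u v : ℝ × E3 → ℝ} (hu : SmoothHalf u)
    (hv : SmoothHalf v) :
    Set.EqOn (fieldDeriv w (u * v)) (fieldDeriv w u * v + u * fieldDeriv w v) halfSpace :=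
  fun p hp => by
  simp [fieldDeriv, fderiv_mul (hu.differentiableAt hp) (hv.differentiableAt hp)]
  ring

/-- The composition of the derivatives along a list of vector fields, the head being outermost. -/
def iterDeriv (K : List (ℝ × E3 → ℝ × E3)) (u : ℝ × E3 → ℝ) : ℝ × E3 → ℝ := K.foldr fieldDeriv u

theorem SmoothHalf.iterDeriv {K : List (ℝ × E3 → ℝ × E3)}
    (hK : ∀ w ∈ K, ContDiff ℝ (⊤ : ℕ∞) w) {u : ℝ × E3 → ℝ} (hu : SmoothHalf u) :
    SmoothHalf (iterDeriv K u) := by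
  induction K with
  | nil => exact hu
  | cons w K ih =>
    exact SmoothHalf.fieldDeriv (hK w (by simp)) (ih fun w' h => hK w' (by simp [h]))

theorem iterDeriv_congr (K : List (ℝ × E3 → ℝ × E3)) {u v : ℝ × E3 → ℝ}
    (h : Set.EqOn u v halfSpace) : Set.EqOn (iterDeriv K u) (iterDeriv K v) halfSpace := by
  induction K with
  | nil => exact h
  | cons w K ih => exact fieldDeriv_congr w ih

theorem iterDeriv_add {K : List (ℝ × E3 → ℝ × E3)} (hK : ∀ w ∈ K, ContDiff ℝ (⊤ : ℕ∞) w)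
    {u v : ℝ × E3 → ℝ} (hu : SmoothHalf u) (hv : SmoothHalf v) :
    Set.EqOn (iterDeriv K (u + v)) (iterDeriv K u + iterDeriv K v) halfSpace := by
  induction K with
  | nil => exact fun _ _ => rfl
  | cons w K ih =>
    have hK' : ∀ w ∈ K, ContDiff ℝ (⊤ : ℕ∞) w := fun w' h => hK w' (by simp [h])
    exact (fieldDeriv_congr w (ih hK')).trans
      (fieldDeriv_add w (SmoothHalf.iterDeriv hK' hu) (SmoothHalf.iterDeriv hK' hv))

/-- The function `1 / t`. -/
def invTime : ℝ × E3 → ℝ := fun p => p.1⁻¹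

/-- The function `xᵃ / t`. -/
def slopeFn (a : Fin 3) : ℝ × E3 → ℝ := fun p => p.2 a * p.1⁻¹

/-- The algebra of functions generated by `1 / t` and the `xᵃ / t`. -/
def coeffAlg : Subalgebra ℝ (ℝ × E3 → ℝ) := Algebra.adjoin ℝ ({invTime} ∪ Set.range slopeFn)

theorem invTime_mem : invTime ∈ coeffAlg := Algebra.subset_adjoin (by simp)

theorem slope_mem (a : Fin 3) : slopeFn a ∈ coeffAlg := Algebra.subset_adjoin (by simp)

theorem smoothHalf_invTime : SmoothHalf invTime :=
  contDiff_fst.contDiffOn.inv fun _ hp => ne_of_gt hp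

theorem contDiff_coord (a : Fin 3) : ContDiff ℝ (⊤ : ℕ∞) fun p : ℝ × E3 => p.2 a :=
  (EuclideanSpace.proj (𝕜 := ℝ) a).contDiff.comp contDiff_snd

theorem smoothHalf_slope (a : Fin 3) : SmoothHalf (slopeFn a) :=
  (contDiff_coord a).contDiffOn.mul smoothHalf_invTime

theorem smoothHalf_of_mem {c : ℝ × E3 → ℝ} (hc : c ∈ coeffAlg) : SmoothHalf c := by
  induction hc using Algebra.adjoin_induction with
  | mem c h =>
    rcases h with rfl | ⟨a, rfl⟩
    · exact smoothHalf_invTime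
    · exact smoothHalf_slope a
  | algebraMap r => exact contDiffOn_const
  | add f g _ _ hf hg => exact hf.add hg
  | mul f g _ _ hf hg => exact hf.mul hg

theorem exists_bound_of_mem {c : ℝ × E3 → ℝ} (hc : c ∈ coeffAlg) :
    ∃ C : ℝ, 0 ≤ C ∧ ∀ p : ℝ × E3, 1 ≤ p.1 → ‖p.2‖ ≤ p.1 → |c p| ≤ C := by
  induction hc using Algebra.adjoin_induction with
  | mem c h =>
    refine ⟨1, zero_le_one, fun p h1 h2 => ?_⟩
    have h0 : 0 < p.1 := by linarith
    rcases h with rfl | ⟨a, rfl⟩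
    · rw [invTime, abs_of_pos (by positivity)]
      exact inv_le_one_of_one_le₀ h1
    · rw [slopeFn, abs_mul, abs_of_pos (inv_pos.2 h0), ← div_eq_mul_inv, div_le_one h0]
      exact (PiLp.norm_apply_le p.2 a).trans h2
  | algebraMap r => exact ⟨|r|, abs_nonneg r, fun p _ _ => le_of_eq rfl⟩
  | add f g _ _ hf hg =>
    obtain ⟨C, hC, h⟩ := hf
    obtain ⟨D, hD, h'⟩ := hg
    exact ⟨C + D, by positivity, fun p h1 h2 =>
      (abs_add_le _ _).trans (add_le_add (h p h1 h2) (h' p h1 h2))⟩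
  | mul f g _ _ hf hg =>
    obtain ⟨C, hC, h⟩ := hf
    obtain ⟨D, hD, h'⟩ := hg
    refine ⟨C * D, by positivity, fun p h1 h2 => ?_⟩
    rw [Pi.mul_apply, abs_mul]
    exact mul_le_mul (h p h1 h2) (h' p h1 h2) (abs_nonneg _) hC

/-- A smooth vector field whose components, divided by `t`, agree on the half-space with elements
of the coefficient algebra. -/
structure IsAdmissible (w : ℝ × E3 → ℝ × E3) : Prop where
  contDiff : ContDiff ℝ (⊤ : ℕ∞) w
  time : ∃ f ∈ coeffAlg, ∀ p ∈ halfSpace, (w p).1 * p.1⁻¹ = f p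
  space : ∀ a, ∃ f ∈ coeffAlg, ∀ p ∈ halfSpace, (w p).2 a * p.1⁻¹ = f p

theorem fieldDeriv_invTime (w : ℝ × E3 → ℝ × E3) {p : ℝ × E3} (hp : p ∈ halfSpace) :
    fieldDeriv w invTime p = -((w p).1 * p.1⁻¹) * p.1⁻¹ := by
  have h := (hasDerivAt_inv (ne_of_gt hp)).comp_hasFDerivAt p
    (hasFDerivAt_fst (𝕜 := ℝ) (p := p))
  have h' : HasFDerivAt invTime _ p := h
  rw [fieldDeriv, h'.fderiv]
  simp
  ring

theorem fieldDeriv_slope (w : ℝ × E3 → ℝ × E3) (a : Fin 3) {p : ℝ × E3} (hp : p ∈ halfSpace) :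
    fieldDeriv w (slopeFn a) p = (w p).2 a * p.1⁻¹ - slopeFn a p * ((w p).1 * p.1⁻¹) := by
  have h : fieldDeriv w (fun p => p.2 a) p = (w p).2 a := by
    have h' : HasFDerivAt (fun p : ℝ × E3 => p.2 a) _ p :=
      ((EuclideanSpace.proj (𝕜 := ℝ) a).comp (ContinuousLinearMap.snd ℝ ℝ E3)).hasFDerivAt
    rw [fieldDeriv, h'.fderiv]
    simp
  have hm := fieldDeriv_mul w (contDiff_coord a).contDiffOn smoothHalf_invTime hp
  refine hm.trans ?_
  simp only [Pi.add_apply, Pi.mul_apply, h, fieldDeriv_invTime w hp, slopeFn, invTime]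
  ring

theorem IsAdmissible.exists_fieldDeriv {w : ℝ × E3 → ℝ × E3} (hw : IsAdmissible w)
    {c : ℝ × E3 → ℝ} (hc : c ∈ coeffAlg) :
    ∃ c' ∈ coeffAlg, Set.EqOn (fieldDeriv w c) c' halfSpace := by
  obtain ⟨f, hf, hf'⟩ := hw.time
  induction hc using Algebra.adjoin_induction with
  | mem c h =>
    rcases h with rfl | ⟨a, rfl⟩
    · refine ⟨-f * invTime, mul_mem (neg_mem hf) invTime_mem, fun p hp => ?_⟩
      rw [fieldDeriv_invTime w hp, hf' p hp]
      rfl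
    · obtain ⟨g, hg, hg'⟩ := hw.space a
      refine ⟨g - slopeFn a * f, sub_mem hg (mul_mem (slope_mem a) hf), fun p hp => ?_⟩
      rw [fieldDeriv_slope w a hp, hf' p hp, hg' p hp]
      rfl
  | algebraMap r =>
    refine ⟨0, zero_mem _, fun p _ => ?_⟩
    have : fderiv ℝ (algebraMap ℝ (ℝ × E3 → ℝ) r) p = 0 := (hasFDerivAt_const r p).fderiv
    simp [fieldDeriv, this]
  | add u v hu hv h1 h2 =>
    obtain ⟨f1, hf1, e1⟩ := h1
    obtain ⟨f2, hf2, e2⟩ := h2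
    refine ⟨f1 + f2, add_mem hf1 hf2, fun p hp => ?_⟩
    rw [fieldDeriv_add w (smoothHalf_of_mem hu) (smoothHalf_of_mem hv) hp]
    simp [e1 hp, e2 hp]
  | mul u v hu hv h1 h2 =>
    obtain ⟨f1, hf1, e1⟩ := h1
    obtain ⟨f2, hf2, e2⟩ := h2
    refine ⟨f1 * v + u * f2, add_mem (mul_mem hf1 hv) (mul_mem hu hf2), fun p hp => ?_⟩
    rw [fieldDeriv_mul w (smoothHalf_of_mem hu) (smoothHalf_of_mem hv) hp]
    simp [e1 hp, e2 hp]

theorem IsAdmissible.exists_fieldDeriv_weight {w : ℝ × E3 → ℝ × E3} (hw : IsAdmissible w)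
    {c : ℝ × E3 → ℝ} (hc : c ∈ coeffAlg) :
    ∃ c' ∈ coeffAlg, ∀ v, SmoothHalf v →
      Set.EqOn (fieldDeriv w (invTime ^ 2 * c * v))
        (invTime ^ 2 * c' * v + invTime ^ 2 * c * fieldDeriv w v) halfSpace := by
  obtain ⟨f, hf, hf'⟩ := hw.time
  obtain ⟨d, hd, hd'⟩ := hw.exists_fieldDeriv hc
  have hs := smoothHalf_invTime
  have hcs := smoothHalf_of_mem hc
  refine ⟨d - (f * c + f * c), sub_mem hd (add_mem (mul_mem hf hc) (mul_mem hf hc)),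
    fun v hv p hp => ?_⟩
  have e0 := fieldDeriv_mul w ((hs.pow 2).mul hcs) hv hp
  have e1 := fieldDeriv_mul w (hs.pow 2) hcs hp
  have e2 := fieldDeriv_mul w hs hs hp
  refine e0.trans ?_
  simp only [Pi.add_apply, Pi.mul_apply, Pi.sub_apply, Pi.pow_apply] at e1 e2 ⊢
  have e3 : fieldDeriv w (fun p => invTime p ^ 2) p = fieldDeriv w (invTime * invTime) p := by
    congr 1
    ext q
    simp [sq]
  have e4 : (fun y => invTime y ^ 2 * c y) = (fun p => invTime p ^ 2) * c := rfl
  rw [e4, e1, e3, e2, hd' hp, fieldDeriv_invTime w hp, hf' p hp]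
  simp only [invTime]
  ring

/-- Leibniz estimate: if every derivative of `v` along a sublist of `K` is at most `M` at a point of
the light cone, the `K`-derivative of `t⁻² c v` there is at most a multiple of `t⁻² M`. -/
theorem exists_iterDeriv_weight_le {K : List (ℝ × E3 → ℝ × E3)} (hK : ∀ w ∈ K, IsAdmissible w)
    {c : ℝ × E3 → ℝ} (hc : c ∈ coeffAlg) :
    ∃ C : ℝ, 0 ≤ C ∧ ∀ v, SmoothHalf v → ∀ p : ℝ × E3, 1 ≤ p.1 → ‖p.2‖ ≤ p.1 → ∀ M : ℝ,
      (∀ K', K'.Sublist K → |iterDeriv K' v p| ≤ M) →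
        |iterDeriv K (invTime ^ 2 * c * v) p| ≤ C / p.1 ^ 2 * M := by
  induction K using List.reverseRecOn generalizing c with
  | nil =>
    obtain ⟨C, hC, hb⟩ := exists_bound_of_mem hc
    refine ⟨C, hC, fun v _ p h1 h2 M hM => ?_⟩
    have hv : |v p| ≤ M := hM [] (List.Sublist.refl _)
    have h0 : 0 < p.1 := by linarith
    have e : iterDeriv [] (invTime ^ 2 * c * v) p = c p / p.1 ^ 2 * v p := by
      simp only [iterDeriv, List.foldr_nil, Pi.mul_apply, Pi.pow_apply, invTime]
      ring
    rw [e, abs_mul, abs_div, abs_of_pos (pow_pos h0 2)]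
    gcongr
    exact hb p h1 h2
  | append_singleton K w ih =>
    have hK' : ∀ w ∈ K, IsAdmissible w := fun w' h => hK w' (by simp [h])
    have hw : IsAdmissible w := hK w (by simp)
    obtain ⟨c', hc', he⟩ := hw.exists_fieldDeriv_weight hc
    obtain ⟨C, hC, hb⟩ := ih hK' hc
    obtain ⟨C', hC', hb'⟩ := ih hK' hc'
    refine ⟨C' + C, by positivity, fun v hv p h1 h2 M hM => ?_⟩
    have hp : p ∈ halfSpace := lt_of_lt_of_le one_pos h1
    have hsm : ∀ {d}, d ∈ coeffAlg → ∀ {f}, SmoothHalf f → SmoothHalf (invTime ^ 2 * d * f) :=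
      fun hd f hf => ((smoothHalf_invTime.pow 2).mul (smoothHalf_of_mem hd)).mul hf
    have happ : ∀ (L : List (ℝ × E3 → ℝ × E3)) (f : ℝ × E3 → ℝ),
        iterDeriv (L ++ [w]) f = iterDeriv L (fieldDeriv w f) := fun L f => by simp [iterDeriv]
    have hw' := SmoothHalf.fieldDeriv hw.contDiff hv
    rw [happ, iterDeriv_congr K (he v hv) hp,
      iterDeriv_add (fun w h => (hK' w h).contDiff) (hsm hc' hv) (hsm hc hw') hp]
    have b1 := hb' v hv p h1 h2 M fun K' h =>
      hM K' (h.trans (List.sublist_append_left K [w]))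
    have b2 := hb _ hw' p h1 h2 M fun K' h => by
      rw [← happ]
      exact hM _ (h.append (List.Sublist.refl [w]))
    refine (abs_add_le _ _).trans ((add_le_add b1 b2).trans (le_of_eq ?_))
    ring

/-- The vector field of the Lorentz boost `L_a`. -/
def boostField (a : Fin 3) : ℝ × E3 → ℝ × E3 := fun p => (p.2 a, p.1 • EuclideanSpace.single a 1)

theorem Lb_eq_fieldDeriv (a : Fin 3) : Lb a = fieldDeriv (boostField a) := by
  funext u p
  have : boostField a p = p.2 a • ((1 : ℝ), (0 : E3)) +
      p.1 • ((0 : ℝ), EuclideanSpace.single a (1 : ℝ)) := by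
    simp [boostField]
  rw [fieldDeriv, this, map_add, map_smul, map_smul]
  rfl

theorem isAdmissible_const (d : ℝ × E3) : IsAdmissible fun _ => d where
  contDiff := contDiff_const
  time := ⟨d.1 • invTime, coeffAlg.smul_mem invTime_mem _, fun _ _ => rfl⟩
  space a := ⟨d.2 a • invTime, coeffAlg.smul_mem invTime_mem _, fun _ _ => rfl⟩

theorem isAdmissible_boostField (a : Fin 3) : IsAdmissible (boostField a) where
  contDiff := (contDiff_coord a).prodMk (contDiff_fst.smul contDiff_const)
  time := ⟨slopeFn a, slope_mem a, fun _ _ => rfl⟩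
  space b := by
    refine ⟨algebraMap ℝ _ ((EuclideanSpace.single a (1 : ℝ) : E3) b), coeffAlg.algebraMap_mem _,
      fun p hp => ?_⟩
    have h0 : p.1 ≠ 0 := ne_of_gt hp
    simp only [boostField, PiLp.smul_apply, smul_eq_mul, Pi.algebraMap_apply, Algebra.algebraMap_self,
      RingHom.id_apply]
    field_simp

/-- The list of vector fields underlying `∂^I L^J`. -/
def fieldList (I : List (Fin 4)) (J : List (Fin 3)) : List (ℝ × E3 → ℝ × E3) :=
  I.map (fun α _ => dir4 α) ++ J.map boostField

theorem isAdmissible_of_mem_fieldList {I : List (Fin 4)} {J : List (Fin 3)}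
    {w : ℝ × E3 → ℝ × E3} (hw : w ∈ fieldList I J) : IsAdmissible w := by
  rcases List.mem_append.1 hw with h | h
  · obtain ⟨α, -, rfl⟩ := List.mem_map.1 h
    exact isAdmissible_const _
  · obtain ⟨a, -, rfl⟩ := List.mem_map.1 h
    exact isAdmissible_boostField a

theorem iterDeriv_fieldList (I : List (Fin 4)) (J : List (Fin 3)) (u : ℝ × E3 → ℝ) :
    iterDeriv (fieldList I J) u = I.foldr pd (J.foldr Lb u) := by
  simp only [iterDeriv, fieldList, List.foldr_append, List.foldr_map]
  congr 1
  congr 1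
  funext a
  rw [Lb_eq_fieldDeriv]

theorem exists_eq_fieldList_of_sublist {I : List (Fin 4)} {J : List (Fin 3)}
    {K : List (ℝ × E3 → ℝ × E3)} (h : K.Sublist (fieldList I J)) :
    ∃ I' J', I'.length ≤ I.length ∧ J'.length ≤ J.length ∧ K = fieldList I' J' := by
  obtain ⟨K₁, K₂, rfl, h₁, h₂⟩ := List.sublist_append_iff.1 h
  obtain ⟨I', hI, rfl⟩ := List.sublist_map_iff.1 h₁
  obtain ⟨J', hJ, rfl⟩ := List.sublist_map_iff.1 h₂
  exact ⟨I', J', hI.length_le, hJ.length_le, rfl⟩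

theorem le_sum_ofFn {m n : ℕ} {f : List (Fin 4) → List (Fin 3) → ℝ} (hf : ∀ I J, 0 ≤ f I J)
    {I : List (Fin 4)} {J : List (Fin 3)} (hI : I.length ≤ m) (hJ : J.length ≤ n) :
    f I J ≤ ∑ m' ∈ Finset.range (m + 1), ∑ n' ∈ Finset.range (n + 1),
      ∑ I' : Fin m' → Fin 4, ∑ J' : Fin n' → Fin 3, f (List.ofFn I') (List.ofFn J') := by
  calc f I J = f (List.ofFn I.get) (List.ofFn J.get) := by simp
    _ ≤ ∑ J' : Fin J.length → Fin 3, f (List.ofFn I.get) (List.ofFn J') :=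
      Finset.single_le_sum (f := fun J' : Fin J.length → Fin 3 =>
        f (List.ofFn I.get) (List.ofFn J')) (fun _ _ => hf _ _) (Finset.mem_univ _)
    _ ≤ ∑ I' : Fin I.length → Fin 4, ∑ J' : Fin J.length → Fin 3,
          f (List.ofFn I') (List.ofFn J') :=
      Finset.single_le_sum (f := fun I' : Fin I.length → Fin 4 =>
        ∑ J' : Fin J.length → Fin 3, f (List.ofFn I') (List.ofFn J'))
        (fun _ _ => Finset.sum_nonneg fun _ _ => hf _ _) (Finset.mem_univ _)
    _ ≤ ∑ n' ∈ Finset.range (n + 1), ∑ I' : Fin I.length → Fin 4, ∑ J' : Fin n' → Fin 3,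
          f (List.ofFn I') (List.ofFn J') :=
      Finset.single_le_sum (f := fun n' => ∑ I' : Fin I.length → Fin 4, ∑ J' : Fin n' → Fin 3,
          f (List.ofFn I') (List.ofFn J'))
        (fun _ _ => Finset.sum_nonneg fun _ _ => Finset.sum_nonneg fun _ _ => hf _ _)
        (Finset.mem_range.2 (by omega))
    _ ≤ _ :=
      Finset.single_le_sum (f := fun m' => ∑ n' ∈ Finset.range (n + 1), ∑ I' : Fin m' → Fin 4,
          ∑ J' : Fin n' → Fin 3, f (List.ofFn I') (List.ofFn J'))
        (fun _ _ => Finset.sum_nonneg fun _ _ => Finset.sum_nonneg fun _ _ =>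
          Finset.sum_nonneg fun _ _ => hf _ _)
        (Finset.mem_range.2 (by omega))

theorem sh_eqOn (a : Fin 3) (u : ℝ × E3 → ℝ) : Set.EqOn (sh a u) (invTime * Lb a u) halfSpace := by
  intro p hp
  have h0 : p.1 ≠ 0 := ne_of_gt hp
  simp only [sh, Lb, invTime, Pi.mul_apply]
  field_simp

theorem smoothHalf_Lb (a : Fin 3) {u : ℝ × E3 → ℝ} (hu : SmoothHalf u) : SmoothHalf (Lb a u) := by
  rw [Lb_eq_fieldDeriv]
  exact SmoothHalf.fieldDeriv (isAdmissible_boostField a).contDiff hu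

theorem sh_sh_eqOn (a b : Fin 3) {u : ℝ × E3 → ℝ} (hu : SmoothHalf u) :
    Set.EqOn (sh a (sh b u))
      (invTime ^ 2 * 1 * Lb a (Lb b u) + invTime ^ 2 * (-slopeFn a) * Lb b u) halfSpace := by
  intro p hp
  have e := fieldDeriv_mul (boostField a) smoothHalf_invTime (smoothHalf_Lb b hu) hp
  have e' := fieldDeriv_congr (boostField a) (sh_eqOn b u) hp
  rw [sh_eqOn a _ hp]
  simp only [Pi.mul_apply, Pi.add_apply, Pi.pow_apply, Pi.neg_apply, Pi.one_apply]
  have e2 : Lb a (sh b u) p = _ := (congrFun (congrFun (Lb_eq_fieldDeriv a) _) p).trans (e'.trans e)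
  rw [e2]
  simp only [Pi.mul_apply, Pi.add_apply, fieldDeriv_invTime _ hp]
  simp only [← Lb_eq_fieldDeriv, boostField, invTime, slopeFn]
  ring

/-- Commutator-type estimate for two tangential (semi-hyperboloidal) derivatives:
`|∂^I L^J (∂̲_a ∂̲_b u)| ≤ C t⁻² Σ_{|I'| ≤ |I|, |J'| ≤ |J|}
  (|∂^{I'} L^{J'} (L_a L_b u)| + |∂^{I'} L^{J'} (L_b u)|)`
at points with `t ≥ 1`, `|x| ≤ t`. -/
theorem stmt4 (m n : ℕ) (I : Fin m → Fin 4) (J : Fin n → Fin 3) (a b : Fin 3) :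
    ∃ C : ℝ, 0 < C ∧
      ∀ u : ℝ × E3 → ℝ, ContDiffOn ℝ (⊤ : ℕ∞) u {p : ℝ × E3 | 0 < p.1} →
        ∀ p : ℝ × E3, 1 ≤ p.1 → ‖p.2‖ ≤ p.1 →
          |pdF I (LbF J (sh a (sh b u))) p| ≤
            C / p.1 ^ 2 *
              ∑ m' ∈ Finset.range (m + 1), ∑ n' ∈ Finset.range (n + 1),
                ∑ I' : Fin m' → Fin 4, ∑ J' : Fin n' → Fin 3,
                  ( |pdF I' (LbF J' (Lb a (Lb b u))) p|
                    + |pdF I' (LbF J' (Lb b u)) p| ) := by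
  have hK : ∀ w ∈ fieldList (List.ofFn I) (List.ofFn J), IsAdmissible w :=
    fun w hw => isAdmissible_of_mem_fieldList hw
  obtain ⟨C₁, hC₁, h₁⟩ := exists_iterDeriv_weight_le hK coeffAlg.one_mem
  obtain ⟨C₂, hC₂, h₂⟩ := exists_iterDeriv_weight_le hK (neg_mem (slope_mem a))
  refine ⟨C₁ + C₂ + 1, by positivity, fun u hu p ht hx => ?_⟩
  have hp : p ∈ halfSpace := lt_of_lt_of_le one_pos ht
  have hLb := smoothHalf_Lb b hu
  have hLab := smoothHalf_Lb a hLb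
  set S := ∑ m' ∈ Finset.range (m + 1), ∑ n' ∈ Finset.range (n + 1),
    ∑ I' : Fin m' → Fin 4, ∑ J' : Fin n' → Fin 3,
      (|pdF I' (LbF J' (Lb a (Lb b u))) p| + |pdF I' (LbF J' (Lb b u)) p|) with hS
  have key : ∀ K' : List (ℝ × E3 → ℝ × E3), K'.Sublist (fieldList (List.ofFn I) (List.ofFn J)) →
      |iterDeriv K' (Lb a (Lb b u)) p| + |iterDeriv K' (Lb b u) p| ≤ S := by
    intro K' hK'
    obtain ⟨I', J', hI, hJ, rfl⟩ := exists_eq_fieldList_of_sublist hK'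
    rw [iterDeriv_fieldList, iterDeriv_fieldList]
    exact le_sum_ofFn (f := fun I' J' => |I'.foldr pd (J'.foldr Lb (Lb a (Lb b u))) p| +
      |I'.foldr pd (J'.foldr Lb (Lb b u)) p|) (fun _ _ => by positivity)
      (by simpa using hI) (by simpa using hJ)
  have b₁ := h₁ _ hLab p ht hx S fun K' h =>
    (le_add_of_nonneg_right (abs_nonneg _)).trans (key K' h)
  have b₂ := h₂ _ hLb p ht hx S fun K' h =>
    (le_add_of_nonneg_left (abs_nonneg _)).trans (key K' h)
  have hS0 : 0 ≤ S := (by positivity : (0 : ℝ) ≤ _).trans (key [] (List.nil_sublist _))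
  have hw := smoothHalf_invTime.pow 2
  have e : pdF I (LbF J (sh a (sh b u))) p = _ :=
    (congrFun (iterDeriv_fieldList (List.ofFn I) (List.ofFn J) (sh a (sh b u))) p).symm.trans
      ((iterDeriv_congr _ (sh_sh_eqOn a b hu) hp).trans
        (iterDeriv_add (fun w h => (hK w h).contDiff)
          ((hw.mul (smoothHalf_of_mem coeffAlg.one_mem)).mul hLab)
          ((hw.mul (smoothHalf_of_mem (neg_mem (slope_mem a)))).mul hLb) hp))
  rw [e]
  refine (abs_add_le _ _).trans ((add_le_add b₁ b₂).trans ?_)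
  rw [← add_mul, ← add_div]
  exact mul_le_mul_of_nonneg_right
    (div_le_div_of_nonneg_right (by linarith) (by positivity)) hS0
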